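/- arXiv:1912.00294 — 4 statements merged into one kernel-verified Lean document; each statement's English description precedes it below -/
import Mathlib

section
/- For every natural number k, the complexified Clifford algebra ℂl_{2k} of ℝ^{2k} is isomorphic as a ℂ-algebra to the matrix algebra ℂ(2^k) of 2^k × 2^k complex matrices. -/
open scoped TensorProduct

/-- The negative-definite quadratic form `Q x = -‖x‖²` on `ℝⁿ`. -/
noncomputable def Qr (n : ℕ) : QuadraticForm ℝ (Fin n → ℝ) :=
  QuadraticMap.weightedSumSquares ℝ (fun _ : Fin n => (-1 : ℝ))

/-- The real Clifford algebra `Cl_n` of `ℝⁿ` with `Q x = -‖x‖²`. -/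
noncomputable abbrev Cl (n : ℕ) := CliffordAlgebra (Qr n)

/-- The complexified Clifford algebra `ℂl_n = ℂ ⊗_ℝ Cl_n`. -/
noncomputable abbrev CliffC (n : ℕ) := ℂ ⊗[ℝ] Cl n

/-- The canonical embedding `ℝⁿ → ℂl_n`. -/
noncomputable def iotaC (n : ℕ) (v : Fin n → ℝ) : CliffC n :=
  (1 : ℂ) ⊗ₜ[ℝ] (CliffordAlgebra.ι (Qr n) v)

/-- The canonical inclusion `Cl_n → ℂl_n`. -/
noncomputable def inclC (n : ℕ) : Cl n →ₐ[ℝ] CliffC n :=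
  Algebra.TensorProduct.includeRight

/-- The conjugate-linear antiautomorphism `τ` of `ℂl_n`: the composite of complex
conjugation of the scalars, the grade involution and reversal.  It satisfies
`τ (a e_{i₁} ⋯ e_{i_r}) = (-1)^r ā e_{i_r} ⋯ e_{i₁}`, in particular `τ (ι v) = -ι v`
for `v ∈ ℝⁿ`, `τ (x * y) = τ y * τ x` and `τ ∘ τ = id`. -/
noncomputable def tau (n : ℕ) : CliffC n →ₗ[ℝ] CliffC n :=
  TensorProduct.map (Complex.conjAe.toLinearMap)
    ((CliffordAlgebra.reverse (Q := Qr n)).comp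
      (CliffordAlgebra.involute (Q := Qr n)).toLinearMap)

/-- A family of Clifford generators of a complex matrix algebra. -/
def IsGamma {I n : Type} [Fintype n] [DecidableEq n] (g : I → Matrix n n ℂ) : Prop :=
  (∀ i, g i * g i = -1) ∧ (∀ i j, i ≠ j → g i * g j + g j * g i = 0) ∧
    Algebra.adjoin ℂ (Set.range g) = ⊤

theorem IsGamma.reindex {I n J m : Type} [Fintype n] [DecidableEq n] [Fintype m] [DecidableEq m]
    {g : I → Matrix n n ℂ} (h : IsGamma g) (e : J ≃ I) (f : n ≃ m) :
    IsGamma (fun j => Matrix.reindexAlgEquiv ℂ ℂ f (g (e j))) := by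
  obtain ⟨h1, h2, h3⟩ := h
  refine ⟨fun i => ?_, fun i j hij => ?_, ?_⟩
  · rw [← map_mul, h1, map_neg, map_one]
  · rw [← map_mul, ← map_mul, ← map_add, h2 _ _ (fun h => hij (e.injective h)), map_zero]
  · have : Set.range (fun j => Matrix.reindexAlgEquiv ℂ ℂ f (g (e j)))
        = Set.image (Matrix.reindexAlgEquiv ℂ ℂ f).toAlgHom (Set.range g) := by
      ext x
      constructor
      · rintro ⟨j, rfl⟩
        exact ⟨_, ⟨e j, rfl⟩, rfl⟩
      · rintro ⟨_, ⟨i, rfl⟩, rfl⟩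
        exact ⟨e.symm i, by simp⟩
    rw [this, Algebra.adjoin_image, h3, Algebra.map_top, AlgHom.range_eq_top]
    exact (Matrix.reindexAlgEquiv ℂ ℂ f).surjective

/-- The doubled family of generators. -/
noncomputable def dbl {I n : Type} [DecidableEq n] (g : I → Matrix n n ℂ) :
    I ⊕ Bool → Matrix (n ⊕ n) (n ⊕ n) ℂ
  | .inl i => Matrix.fromBlocks (g i) 0 0 (-g i)
  | .inr true => Matrix.fromBlocks 0 1 (-1) 0
  | .inr false => Matrix.fromBlocks 0 (Complex.I • 1) (Complex.I • 1) 0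

theorem IsGamma.dbl {I n : Type} [Fintype n] [DecidableEq n]
    {g : I → Matrix n n ℂ} (h : IsGamma g) : IsGamma (dbl g) := by
  obtain ⟨h1, h2, h3⟩ := h
  have hneg : (-1 : Matrix (n ⊕ n) (n ⊕ n) ℂ) = Matrix.fromBlocks (-1) 0 0 (-1) := by
    rw [← Matrix.fromBlocks_one, Matrix.fromBlocks_neg]; simp
  refine ⟨?_, ?_, ?_⟩
  · rintro (i | _ | _)
    · simp [_root_.dbl, Matrix.fromBlocks_multiply, h1, hneg]
    · simp [_root_.dbl, Matrix.fromBlocks_multiply, hneg, smul_smul]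
    · simp [_root_.dbl, Matrix.fromBlocks_multiply, hneg]
  · rintro (i | _ | _) (j | _ | _) hij
    · have := h2 i j (fun h => hij (by rw [h]))
      simp [_root_.dbl, Matrix.fromBlocks_multiply, Matrix.fromBlocks_add, this]
    all_goals first
      | exact absurd rfl hij
      | simp [_root_.dbl, Matrix.fromBlocks_multiply, Matrix.fromBlocks_add]
  · set S := Algebra.adjoin ℂ (Set.range (_root_.dbl g)) with hS
    have hm : ∀ i, _root_.dbl g i ∈ S := fun i => Algebra.subset_adjoin ⟨i, rfl⟩
    have hE : (Matrix.fromBlocks 0 1 (-1) 0 : Matrix (n ⊕ n) (n ⊕ n) ℂ) ∈ S := hm (.inr true)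
    have hF : (Matrix.fromBlocks 0 (Complex.I • 1) (Complex.I • 1) 0 :
      Matrix (n ⊕ n) (n ⊕ n) ℂ) ∈ S := hm (.inr false)
    have hP : (Matrix.fromBlocks 1 0 0 0 : Matrix (n ⊕ n) (n ⊕ n) ℂ) ∈ S := by
      have := S.smul_mem (S.add_mem S.one_mem
        (S.smul_mem (S.mul_mem hE hF) (-Complex.I))) (1/2 : ℂ)
      convert this using 1
      rw [← Matrix.fromBlocks_one]
      simp only [Matrix.fromBlocks_multiply, Matrix.fromBlocks_add, Matrix.fromBlocks_smul]
      simp [smul_smul, ← two_smul ℂ (1 : Matrix n n ℂ)]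
    have hD : ∀ x : Matrix n n ℂ, Matrix.fromBlocks x 0 0 0 ∈ S := by
      intro x
      have hx : x ∈ Algebra.adjoin ℂ (Set.range g) := by rw [h3]; trivial
      induction hx using Algebra.adjoin_induction with
      | mem x hx =>
        obtain ⟨i, rfl⟩ := hx
        have := S.mul_mem hP (hm (.inl i))
        simpa [_root_.dbl, Matrix.fromBlocks_multiply] using this
      | algebraMap r =>
        have := S.smul_mem hP r
        simpa [Matrix.fromBlocks_smul, Algebra.algebraMap_eq_smul_one] using this
      | add x y _ _ hx hy =>
        simpa [Matrix.fromBlocks_add] using S.add_mem hx hy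
      | mul x y _ _ hx hy =>
        simpa [Matrix.fromBlocks_multiply] using S.mul_mem hx hy
    rw [eq_top_iff]
    intro x _
    rw [← Matrix.fromBlocks_toBlocks x]
    have := S.add_mem (S.add_mem (hD x.toBlocks₁₁) (S.mul_mem (hD x.toBlocks₁₂) hE))
      (S.add_mem (S.mul_mem hE (hD (-x.toBlocks₂₁)))
        (S.mul_mem (S.mul_mem hE (hD (-x.toBlocks₂₂))) hE))
    simpa [Matrix.fromBlocks_multiply, Matrix.fromBlocks_add] using this

theorem exists_gamma (k : ℕ) :
    ∃ g : Fin (2 * k) → Matrix (Fin (2 ^ k)) (Fin (2 ^ k)) ℂ, IsGamma g := by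
  induction k with
  | zero =>
    refine ⟨fun i => i.elim0, fun i => i.elim0, fun i => i.elim0, ?_⟩
    rw [eq_top_iff]
    intro x _
    have : x = algebraMap ℂ _ (x 0 0) := by
      ext i j
      have hi : i = 0 := Subsingleton.elim (α := Fin 1) _ _
      have hj : j = 0 := Subsingleton.elim (α := Fin 1) _ _
      subst hi hj
      simp [Matrix.algebraMap_matrix_apply]
    rw [this]
    exact Subalgebra.algebraMap_mem _ _
  | succ k ih =>
    obtain ⟨g, hg⟩ := ih
    have e : Fin (2 * (k + 1)) ≃ Fin (2 * k) ⊕ Bool :=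
      Fintype.equivOfCardEq (by simp; ring)
    have f : Fin (2 ^ k) ⊕ Fin (2 ^ k) ≃ Fin (2 ^ (k + 1)) :=
      Fintype.equivOfCardEq (by simp; ring)
    exact ⟨_, hg.dbl.reindex e f⟩

theorem finrank_CliffC (n : ℕ) :
    Module.Finite ℂ (CliffC n) ∧ Module.finrank ℂ (CliffC n) = 2 ^ n := by
  have b : Module.Basis (Finset (Fin n)) ℝ (Cl n) :=
    (Pi.basisFun ℝ (Fin n)).ExteriorAlgebra.map (CliffordAlgebra.equivExterior (Qr n)).symm
  have c : Module.Basis (Finset (Fin n)) ℂ (CliffC n) := b.baseChange ℂ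
  exact ⟨Module.Finite.of_basis c, by rw [Module.finrank_eq_card_basis c]; simp⟩

theorem gamma_sq {I n : Type} [Fintype I] [Fintype n] [DecidableEq n]
    {g : I → Matrix n n ℂ} (h : IsGamma g) (v : I → ℝ) :
    (∑ i, v i • g i) * (∑ i, v i • g i) = algebraMap ℝ _ (∑ i, -(v i * v i)) := by
  classical
  obtain ⟨h1, h2, -⟩ := h
  have hk : ∀ i j, g i * g j + g j * g i = if i = j then -2 else 0 := by
    intro i j
    split_ifs with hij
    · subst hij
      rw [h1]; norm_num
    · exact h2 i j hij
  have key : (2 : ℝ) • ((∑ i, v i • g i) * (∑ i, v i • g i))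
      = (2 : ℝ) • algebraMap ℝ (Matrix n n ℂ) (∑ i, -(v i * v i)) := by
    have hA : (∑ i, v i • g i) * (∑ i, v i • g i) = ∑ i, ∑ j, v i • g i * v j • g j :=
      Finset.sum_mul_sum ..
    have hB : (∑ i, v i • g i) * (∑ i, v i • g i) = ∑ i, ∑ j, v j • g j * v i • g i := by
      rw [hA, Finset.sum_comm]
    have hAB := congrArg₂ (· + ·) hA hB
    simp only [← Finset.sum_add_distrib (s := Finset.univ)
      (f := fun i => ∑ j, v i • g i * v j • g j)] at hAB
    rw [two_smul, hAB]
    have : ∀ i, (∑ j, v i • g i * v j • g j) + ∑ j, v j • g j * v i • g i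
        = -(2 : ℝ) • (v i * v i) • (1 : Matrix n n ℂ) := by
      intro i
      rw [← Finset.sum_add_distrib]
      have : ∀ j, v i • g i * v j • g j + v j • g j * v i • g i
          = if i = j then (v i * v j) • (-2 : Matrix n n ℂ) else 0 := by
        intro j
        rw [smul_mul_smul_comm, smul_mul_smul_comm, mul_comm (v j), ← smul_add, hk]
        split_ifs <;> simp
      simp only [this, Finset.sum_ite_eq, Finset.mem_univ, if_true]
      rw [smul_comm, neg_smul, two_smul, ← one_add_one_eq_two, neg_add]
    rw [Finset.sum_congr rfl (fun i _ => this i), Algebra.algebraMap_eq_smul_one,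
      Finset.sum_smul, Finset.smul_sum]
    simp
  exact smul_right_injective _ (two_ne_zero (α := ℝ)) key

/-- For every natural number `k`, the complexified Clifford algebra `ℂl_{2k}` is
isomorphic as a `ℂ`-algebra to the matrix algebra of `2^k × 2^k` complex matrices. -/
theorem stmt0 (k : ℕ) :
    Nonempty (CliffC (2 * k) ≃ₐ[ℂ] Matrix (Fin (2 ^ k)) (Fin (2 ^ k)) ℂ) := by
  obtain ⟨g, hg⟩ := exists_gamma k
  let L : (Fin (2 * k) → ℝ) →ₗ[ℝ] Matrix (Fin (2 ^ k)) (Fin (2 ^ k)) ℂ :=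
    Fintype.linearCombination ℝ g
  have hL : ∀ v, L v * L v = algebraMap ℝ _ (Qr (2 * k) v) := by
    intro v
    have := gamma_sq hg v
    simpa [L, Fintype.linearCombination_apply, Qr, QuadraticMap.weightedSumSquares_apply] using this
  let φ : Cl (2 * k) →ₐ[ℝ] Matrix (Fin (2 ^ k)) (Fin (2 ^ k)) ℂ :=
    CliffordAlgebra.lift (Qr (2 * k)) ⟨L, hL⟩
  let ψ : CliffC (2 * k) →ₐ[ℂ] Matrix (Fin (2 ^ k)) (Fin (2 ^ k)) ℂ :=
    Algebra.TensorProduct.lift (Algebra.ofId ℂ _) φ (fun x y => Algebra.commutes x (φ y))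
  have hsurj : Function.Surjective ψ := by
    rw [← AlgHom.range_eq_top, eq_top_iff, ← hg.2.2, Algebra.adjoin_le_iff]
    rintro _ ⟨i, rfl⟩
    refine ⟨iotaC (2 * k) (Pi.single i 1), ?_⟩
    have h1 : ψ (iotaC (2 * k) (Pi.single i 1)) =
        Algebra.ofId ℂ _ 1 * φ (CliffordAlgebra.ι (Qr (2 * k)) (Pi.single i 1)) :=
      Algebra.TensorProduct.lift_tmul ..
    have h2 : φ (CliffordAlgebra.ι (Qr (2 * k)) (Pi.single i 1)) = L (Pi.single i 1) :=
      CliffordAlgebra.lift_ι_apply ..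
    have h3 : L (Pi.single i 1) = g i := by simp [L]
    exact h1.trans (by rw [h2, h3, map_one, one_mul])
  obtain ⟨hfin, hrank⟩ := finrank_CliffC (2 * k)
  have hdim : Module.finrank ℂ (CliffC (2 * k))
      = Module.finrank ℂ (Matrix (Fin (2 ^ k)) (Fin (2 ^ k)) ℂ) := by
    rw [hrank, Module.finrank_matrix]
    simp
    ring
  have hinj : Function.Injective ψ :=
    (LinearMap.injective_iff_surjective_of_finrank_eq_finrank (f := ψ.toLinearMap) hdim).2 hsurj
  exact ⟨AlgEquiv.ofBijective ψ ⟨hinj, hsurj⟩⟩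
end

section
/- For every natural number k, the complexified Clifford algebra ℂl_{2k+1} of ℝ^{2k+1} is isomorphic as a ℂ-algebra to the product algebra ℂ(2^k) × ℂ(2^k). -/
open scoped TensorProduct

/-- `A` is generated by `n` anticommuting square roots of `-1`, and has one further such
element `w` anticommuting with all of them. -/
def HasGens (A : Type) [Ring A] [Algebra ℂ A] (n : ℕ) : Prop :=
  ∃ (e : Fin n → A) (w : A), (∀ i, e i * e i = -1) ∧
    (∀ i j, i ≠ j → e i * e j = -(e j * e i)) ∧ w * w = -1 ∧
    (∀ i, e i * w = -(w * e i)) ∧ Algebra.adjoin ℂ (Set.range e) = ⊤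

theorem HasGens.map {A B : Type} [Ring A] [Algebra ℂ A] [Ring B] [Algebra ℂ B] {n : ℕ}
    (φ : A ≃ₐ[ℂ] B) (h : HasGens A n) : HasGens B n := by
  obtain ⟨e, w, h1, h2, h3, h4, h5⟩ := h
  refine ⟨fun i => φ (e i), φ w, fun i => ?_, fun i j hij => ?_, ?_, fun i => ?_, ?_⟩
  · rw [← map_mul, h1]; simp
  · rw [← map_mul, h2 i j hij]; simp
  · rw [← map_mul, h3]; simp
  · rw [← map_mul, h4]; simp
  · have : Set.range (fun i => φ (e i)) = (φ : A →ₐ[ℂ] B) '' Set.range e := by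
      rw [← Set.range_comp]; rfl
    rw [this, ← AlgHom.map_adjoin, h5, Algebra.map_top, AlgHom.range_eq_top]
    exact φ.surjective

theorem HasGens.step {A : Type} [Ring A] [Algebra ℂ A] {n : ℕ}
    (h : HasGens A n) : HasGens (Matrix (Fin 2) (Fin 2) A) (n + 2) := by
  obtain ⟨e, w, h1, h2, h3, h4, h5⟩ := h
  set J : A := algebraMap ℂ A Complex.I with hJ
  have hJJ : J * J = -1 := by rw [hJ, ← map_mul, Complex.I_mul_I]; simp
  have hJc : ∀ a : A, a * J = J * a := fun a => (Algebra.commutes _ _).symm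
  let X : A → Matrix (Fin 2) (Fin 2) A := fun a => !![0, a; a, 0]
  let P : Matrix (Fin 2) (Fin 2) A := !![J, 0; 0, -J]
  let R : Matrix (Fin 2) (Fin 2) A := !![0, 1; -1, 0]
  have hneg1 : (-1 : Matrix (Fin 2) (Fin 2) A) = !![-1, 0; 0, -1] := by
    rw [Matrix.one_fin_two]; simp
  have hPP : P * P = -1 := by rw [hneg1]; simp [P, hJJ]
  have hRR : R * R = -1 := by rw [hneg1]; simp [R]
  have hXX : ∀ a, a * a = -1 → X a * X a = -1 := by
    intro a ha; rw [hneg1]; simp [X, ha]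
  have hXX2 : ∀ a b, a * b = -(b * a) → X a * X b = -(X b * X a) := by
    intro a b hab; simp [X, hab]
  have hPR : P * R = -(R * P) := by simp [P, R]
  have hPX : ∀ a, P * X a = -(X a * P) := by intro a; simp [P, X, hJc]
  have hRX : ∀ a, R * X a = -(X a * R) := by intro a; simp [R, X]
  have hsymm : ∀ a b : Matrix (Fin 2) (Fin 2) A, a * b = -(b * a) → b * a = -(a * b) := by
    intro a b hab; rw [hab, neg_neg]
  let E : Fin (n + 2) → Matrix (Fin 2) (Fin 2) A :=
    Fin.cons P (Fin.cons R (fun i => X (e i)))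
  have hE0 : E 0 = P := rfl
  have hE1 : E (Fin.succ 0) = R := rfl
  have hE2 : ∀ i : Fin n, E i.succ.succ = X (e i) := fun i => rfl
  refine ⟨E, X w, ?_, ?_, hXX w h3, ?_, ?_⟩
  · intro i
    refine Fin.cases ?_ (fun i => Fin.cases ?_ (fun i => ?_) i) i
    · rw [hE0, hPP]
    · rw [hE1, hRR]
    · rw [hE2, hXX _ (h1 i)]
  · intro i j
    refine Fin.cases ?_ (fun i => Fin.cases ?_ (fun i => ?_) i) i <;>
    refine Fin.cases ?_ (fun j => Fin.cases ?_ (fun j => ?_) j) j <;>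
    intro hij <;> simp only [hE0, hE1, hE2]
    · exact absurd rfl hij
    · exact hPR
    · exact hPX _
    · exact hsymm _ _ hPR
    · exact absurd rfl hij
    · exact hRX _
    · exact hsymm _ _ (hPX _)
    · exact hsymm _ _ (hRX _)
    · exact hXX2 _ _ (h2 _ _ (fun h => hij (by rw [h])))
  · intro i
    refine Fin.cases ?_ (fun i => Fin.cases ?_ (fun i => ?_) i) i
    · rw [hE0, hPX]
    · rw [hE1, hRX]
    · rw [hE2]; exact hXX2 _ _ (h4 i)
  · set S := Algebra.adjoin ℂ (Set.range E) with hS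
    have hmem : ∀ i, E i ∈ S := fun i => Algebra.subset_adjoin ⟨i, rfl⟩
    have hP : P ∈ S := hmem 0
    have hR : R ∈ S := hmem (Fin.succ 0)
    have hJs : ∀ a : A, (Complex.I • a) = J * a := fun a => Algebra.smul_def _ _
    have hJ1 : (Complex.I • (1 : A)) = J := by rw [hJs, mul_one]
    have hX1 : X 1 ∈ S := by
      have : X 1 = (-Complex.I) • (P * R) := by
        simp [X, P, R, hJs, hJJ]
      rw [this]
      exact S.smul_mem (S.mul_mem hP hR) _
    let D : A →ₐ[ℂ] Matrix (Fin 2) (Fin 2) A := 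
      { toFun := fun a => !![a, 0; 0, a]
        map_one' := Matrix.one_fin_two.symm
        map_mul' := by intro a b; simp
        map_zero' := by ext i j; fin_cases i <;> fin_cases j <;> rfl
        map_add' := by intro a b; simp
        commutes' := by
          intro r; ext i j; fin_cases i <;> fin_cases j <;> simp [Matrix.algebraMap_matrix_apply] }
    have hD' : ∀ a, D a = !![a, 0; 0, a] := fun a => rfl
    have hD : ∀ a, D a ∈ S := by
      have : (⊤ : Subalgebra ℂ A) ≤ S.comap D := by
        rw [← h5, Algebra.adjoin_le_iff]
        rintro _ ⟨i, rfl⟩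
        change D (e i) ∈ S
        have : D (e i) = X (e i) * X 1 := by simp [hD', X]
        rw [this]
        exact S.mul_mem (hmem i.succ.succ) hX1
      intro a
      exact this (Algebra.mem_top (x := a))
    have hZ : !![(1 : A), 0; 0, -1] ∈ S := by
      have : !![(1 : A), 0; 0, -1] = (-Complex.I) • P := by
        simp [P, hJs, hJJ]
      rw [this]
      exact S.smul_mem hP _
    have h00 : !![(1 : A), 0; 0, 0] ∈ S := by
      have : !![(1 : A), 0; 0, 0] = (1 / 2 : ℂ) • (1 + !![(1 : A), 0; 0, -1]) := by
        rw [Matrix.one_fin_two]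
        simp [← two_smul ℂ (1 : A), smul_smul]
      rw [this]
      exact S.smul_mem (S.add_mem S.one_mem hZ) _
    have h11 : !![(0 : A), 0; 0, 1] ∈ S := by
      have : !![(0 : A), 0; 0, 1] = 1 - !![(1 : A), 0; 0, 0] := by
        rw [Matrix.one_fin_two]
        simp
      rw [this]
      exact S.sub_mem S.one_mem h00
    rw [eq_top_iff]
    intro M _
    have hM : M = D (M 0 0) * !![(1 : A), 0; 0, 0] + D (M 0 1) * (!![(1 : A), 0; 0, 0] * X 1)
        + D (M 1 0) * (!![(0 : A), 0; 0, 1] * X 1) + D (M 1 1) * !![(0 : A), 0; 0, 1] := by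
      rw [Matrix.eta_fin_two M]
      simp [hD', X]
    rw [hM]
    exact S.add_mem (S.add_mem (S.add_mem (S.mul_mem (hD _) h00)
      (S.mul_mem (hD _) (S.mul_mem h00 hX1))) (S.mul_mem (hD _) (S.mul_mem h11 hX1)))
      (S.mul_mem (hD _) h11)

theorem hasGens_matrix (k : ℕ) : HasGens (Matrix (Fin (2 ^ k)) (Fin (2 ^ k)) ℂ) (2 * k) := by
  induction k with
  | zero =>
    have hadj : ∀ M : Matrix (Fin (2 ^ 0)) (Fin (2 ^ 0)) ℂ, M = algebraMap ℂ _ (M 0 0) := by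
      intro M
      ext i j
      have hi : i = 0 := Subsingleton.elim (α := Fin 1) _ _
      have hj : j = 0 := Subsingleton.elim (α := Fin 1) _ _
      subst hi hj
      simp [Matrix.algebraMap_matrix_apply]
    refine ⟨fun i => i.elim0, algebraMap ℂ _ Complex.I, fun i => i.elim0, fun i => i.elim0, ?_,
      fun i => i.elim0, ?_⟩
    · rw [← map_mul, Complex.I_mul_I]; simp
    · rw [eq_top_iff]
      intro M _
      rw [hadj M]
      exact Subalgebra.algebraMap_mem _ _
  | succ k ih =>
    exact ih.step.map ((Matrix.compAlgEquiv (Fin 2) (Fin (2 ^ k)) ℂ ℂ).trans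
      (Matrix.reindexAlgEquiv ℂ ℂ (finProdFinEquiv.trans (finCongr (by rw [pow_succ, mul_comm])))))

/-- Odd generators for the product algebra. -/
theorem HasGens.prod {A : Type} [Ring A] [Algebra ℂ A] {n : ℕ} (h : HasGens A n) :
    ∃ E : Fin (n + 1) → A × A, (∀ i, E i * E i = -1) ∧
      (∀ i j, i ≠ j → E i * E j = -(E j * E i)) ∧ Algebra.adjoin ℂ (Set.range E) = ⊤ := by
  obtain ⟨e, w, h1, h2, h3, h4, h5⟩ := h
  let E : Fin (n + 1) → A × A := Fin.cons (w, -w) (fun i => (e i, e i))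
  have hE0 : E 0 = (w, -w) := rfl
  have hE1 : ∀ i : Fin n, E i.succ = (e i, e i) := fun i => rfl
  refine ⟨E, ?_, ?_, ?_⟩
  · intro i
    refine Fin.cases ?_ (fun i => ?_) i
    · rw [hE0]; ext <;> simp [h3]
    · rw [hE1]; ext <;> simp [h1]
  · intro i j
    refine Fin.cases ?_ (fun i => ?_) i <;> refine Fin.cases ?_ (fun j => ?_) j <;>
      intro hij <;> simp only [hE0, hE1]
    · exact absurd rfl hij
    · ext <;> simp [h4]
    · ext <;> simp [h4]
    · have := h2 i j (fun h => hij (by rw [h]))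
      ext <;> simp [this]
  · set S := Algebra.adjoin ℂ (Set.range E) with hS
    have hmem : ∀ i, E i ∈ S := fun i => Algebra.subset_adjoin ⟨i, rfl⟩
    let D : A →ₐ[ℂ] A × A := (AlgHom.id ℂ A).prod (AlgHom.id ℂ A)
    have hD : ∀ a, (a, a) ∈ S := by
      have : (⊤ : Subalgebra ℂ A) ≤ S.comap D := by
        rw [← h5, Algebra.adjoin_le_iff]
        rintro _ ⟨i, rfl⟩
        exact hmem i.succ
      intro a
      exact this (Algebra.mem_top (x := a))
    have hZ : ((1 : A), (-1 : A)) ∈ S := by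
      have : ((1 : A), (-1 : A)) = (w, -w) * (-w, -w) := by ext <;> simp [h3]
      rw [this]
      exact S.mul_mem (hmem 0) (hD _)
    rw [eq_top_iff]
    rintro ⟨a, b⟩ _
    have : (a, b) = (1 / 2 : ℂ) • ((a + b, a + b) + (a - b, a - b) * ((1 : A), (-1 : A))) := by
      ext
      · simp [← two_smul ℂ a, smul_smul]
      · simp only [Prod.smul_snd, Prod.snd_add, Prod.snd_mul, mul_neg, mul_one]
        module
    rw [this]
    exact S.smul_mem (S.add_mem (hD _) (S.mul_mem (hD _) hZ)) _

theorem sq_gens {A : Type} [Ring A] [Algebra ℝ A] {n : ℕ} (E : Fin n → A)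
    (h1 : ∀ i, E i * E i = -1) (h2 : ∀ i j, i ≠ j → E i * E j = -(E j * E i))
    (v : Fin n → ℝ) :
    Fintype.linearCombination ℝ E v * Fintype.linearCombination ℝ E v
      = algebraMap ℝ A (Qr n v) := by
  have key : ∀ i j, (v i • E i) * (v j • E j) + (v j • E j) * (v i • E i)
      = if i = j then (2 : ℝ) • algebraMap ℝ A (-(v i * v i)) else 0 := by
    intro i j
    split_ifs with h
    · subst h
      rw [smul_mul_smul_comm, h1, two_smul, map_neg, Algebra.algebraMap_eq_smul_one]
      simp
    · rw [smul_mul_smul_comm, smul_mul_smul_comm, h2 i j h, mul_comm (v j)]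
      simp
  have hsum : ∑ i, ∑ j, ((v i • E i) * (v j • E j) + (v j • E j) * (v i • E i))
      = (2 : ℝ) • algebraMap ℝ A (Qr n v) := by
    simp only [key, Finset.sum_ite_eq, Finset.mem_univ, if_true]
    rw [← Finset.smul_sum, ← map_sum]
    simp [Qr, QuadraticMap.weightedSumSquares_apply]
  have hs2 : (2 : ℝ) • (Fintype.linearCombination ℝ E v * Fintype.linearCombination ℝ E v)
      = (2 : ℝ) • algebraMap ℝ A (Qr n v) := by
    rw [← hsum, two_smul, Fintype.linearCombination_apply]
    simp only [Finset.sum_add_distrib]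
    congr 1
    · rw [Finset.sum_mul_sum]
    · rw [Finset.sum_mul_sum, Finset.sum_comm]
  exact smul_right_injective A (two_ne_zero (α := ℝ)) hs2

/-- A basis of `ℂl_n` indexed by subsets of `Fin n`. -/
noncomputable def basisCliffC (n : ℕ) : Module.Basis (Finset (Fin n)) ℂ (CliffC n) :=
  Module.Basis.baseChange ℂ
    (((Pi.basisFun ℝ (Fin n)).ExteriorAlgebra).map (CliffordAlgebra.equivExterior (Qr n)).symm)

/-- For every natural number `k`, the complexified Clifford algebra `ℂl_{2k+1}` is
isomorphic as a `ℂ`-algebra to the product algebra `ℂ(2^k) × ℂ(2^k)`. -/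
theorem stmt1 (k : ℕ) :
    Nonempty (CliffC (2 * k + 1) ≃ₐ[ℂ]
      (Matrix (Fin (2 ^ k)) (Fin (2 ^ k)) ℂ × Matrix (Fin (2 ^ k)) (Fin (2 ^ k)) ℂ)) := by
  obtain ⟨E, h1, h2, h3⟩ := (hasGens_matrix k).prod
  let g := CliffordAlgebra.lift (Qr (2 * k + 1))
    ⟨Fintype.linearCombination ℝ E, sq_gens E h1 h2⟩
  let F := Algebra.TensorProduct.lift (Algebra.ofId ℂ _) g (fun x y => Algebra.commutes x (g y))
  have hsurj : Function.Surjective F := by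
    rw [← AlgHom.range_eq_top, eq_top_iff, ← h3, Algebra.adjoin_le_iff]
    rintro _ ⟨i, rfl⟩
    refine ⟨iotaC _ (Pi.single i 1), ?_⟩
    have hg : g (CliffordAlgebra.ι (Qr (2 * k + 1)) (Pi.single i 1)) = E i := by
      refine (CliffordAlgebra.lift_ι_apply _ _ _).trans ?_
      rw [Fintype.linearCombination_apply_single, one_smul]
    have hF : F (iotaC _ (Pi.single i 1)) = E i := by
      refine (Algebra.TensorProduct.lift_tmul _ _ _ _ _).trans ?_
      rw [hg, map_one, one_mul]
    exact hF
  have hfd : FiniteDimensional ℂ (CliffC (2 * k + 1)) :=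
    Module.Finite.of_basis (basisCliffC _)
  have hrank : Module.finrank ℂ (CliffC (2 * k + 1)) = Module.finrank ℂ
      (Matrix (Fin (2 ^ k)) (Fin (2 ^ k)) ℂ × Matrix (Fin (2 ^ k)) (Fin (2 ^ k)) ℂ) := by
    rw [Module.finrank_eq_card_basis (basisCliffC _), Module.finrank_prod, Module.finrank_matrix]
    simp
    ring
  have hinj : Function.Injective F :=
    (LinearMap.injective_iff_surjective_of_finrank_eq_finrank (f := F.toLinearMap) hrank).2 hsurj
  exact ⟨AlgEquiv.ofBijective F ⟨hinj, hsurj⟩⟩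
end

section
/- For every natural number n, there is an isomorphism of ℂ-algebras ℂl_{n+2} ≅ ℂl_n ⊗_ℂ ℂ(2). -/
open scoped TensorProduct

/-! ### Maps out of `ℂ(2)` -/

section Mat

variable {B : Type*} [Ring B] [Algebra ℂ B]

noncomputable def matLin (a b : B) : Matrix (Fin 2) (Fin 2) ℂ →ₗ[ℂ] B where
  toFun m := ((m 0 0 + m 1 1) / 2) • (1 : B) + (-Complex.I * (m 0 0 - m 1 1) / 2) • a
    + ((m 0 1 - m 1 0) / 2) • b + (-Complex.I * (m 0 1 + m 1 0) / 2) • (a * b)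
  map_add' x y := by simp only [Matrix.add_apply]; module
  map_smul' c x := by simp only [Matrix.smul_apply, smul_eq_mul, RingHom.id_apply]; module

theorem matLin_apply (a b : B) (m : Matrix (Fin 2) (Fin 2) ℂ) :
  matLin a b m = ((m 0 0 + m 1 1) / 2) • (1 : B) + (-Complex.I * (m 0 0 - m 1 1) / 2) • a
    + ((m 0 1 - m 1 0) / 2) • b + (-Complex.I * (m 0 1 + m 1 0) / 2) • (a * b) := rfl

noncomputable def matHom (a b : B) (ha : a * a = -1) (hb : b * b = -1) (hab : b * a = -(a * b)) :
    Matrix (Fin 2) (Fin 2) ℂ →ₐ[ℂ] B :=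
  AlgHom.ofLinearMap (matLin a b) (by simp [matLin_apply]) (by
    intro x y
    have h1 : a * (a * b) = -b := by rw [← mul_assoc, ha]; simp
    have h2 : b * (a * b) = a := by rw [← mul_assoc, hab, neg_mul, mul_assoc, hb]; simp
    have h3 : a * b * a = b := by rw [mul_assoc, hab, mul_neg, h1]; simp
    have h4 : a * b * b = -a := by rw [mul_assoc, hb]; simp
    have h5 : a * b * (a * b) = -1 := by rw [mul_assoc, h2, ha]
    simp only [matLin_apply, Matrix.mul_apply, Fin.sum_univ_two, add_mul, mul_add,
      smul_mul_smul_comm, one_mul, mul_one, ha, hb, hab, h1, h2, h3, h4, h5]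
    have I2 := Complex.I_mul_I
    match_scalars <;> ring_nf <;> simp only [Complex.I_sq] <;> ring)

theorem matHom_apply (a b : B) (ha : a * a = -1) (hb : b * b = -1) (hab : b * a = -(a * b))
    (m : Matrix (Fin 2) (Fin 2) ℂ) : matHom a b ha hb hab m = matLin a b m := rfl

end Mat

/-! ### The generators -/

noncomputable def M1 : Matrix (Fin 2) (Fin 2) ℂ := !![Complex.I, 0; 0, -Complex.I]
noncomputable def M2 : Matrix (Fin 2) (Fin 2) ℂ := !![0, 1; -1, 0]
noncomputable def MK : Matrix (Fin 2) (Fin 2) ℂ := !![0, 1; 1, 0]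

theorem M11 : M1 * M1 = -1 := by
  ext i j; fin_cases i <;> fin_cases j <;> simp [M1]
theorem M22 : M2 * M2 = -1 := by
  ext i j; fin_cases i <;> fin_cases j <;> simp [M2]
theorem MKK : MK * MK = 1 := by
  ext i j; fin_cases i <;> fin_cases j <;> simp [MK]
theorem M21 : M2 * M1 = -(M1 * M2) := by
  ext i j; fin_cases i <;> fin_cases j <;> simp [M1, M2]
theorem MK1 : MK * M1 = -(M1 * MK) := by
  ext i j; fin_cases i <;> fin_cases j <;> simp [M1, MK]
theorem MK2 : MK * M2 = -(M2 * MK) := by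
  ext i j; fin_cases i <;> fin_cases j <;> simp [M2, MK]
theorem M12 : M1 * M2 = Complex.I • MK := by
  ext i j; fin_cases i <;> fin_cases j <;> simp [M1, M2, MK]
theorem matLin_M (m : Matrix (Fin 2) (Fin 2) ℂ) : matLin M1 M2 m = m := by
  rw [matLin_apply, M12]
  ext i j; fin_cases i <;> fin_cases j <;> simp [M1, M2, MK] <;> ring_nf <;>
    simp only [Complex.I_sq] <;> ring


theorem Qr_apply (n : ℕ) (v) : Qr n v = - ∑ i, v i * v i := by
  simp [Qr, QuadraticMap.weightedSumSquares_apply]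

/-- `A` with `f` is a model of the complex Clifford algebra of `ℝⁿ`. -/
structure IsCliff (n : ℕ) (A : Type) [Ring A] [Algebra ℂ A] (f : (Fin n → ℝ) →ₗ[ℝ] A) : Prop where
  sq : ∀ v, f v * f v = algebraMap ℂ A (Qr n v : ℝ)
  gen : Algebra.adjoin ℂ (Set.range f) = ⊤
  lift : ∀ (B : Type) [Ring B] [Algebra ℂ B] (g : (Fin n → ℝ) →ₗ[ℝ] B),
    (∀ v, g v * g v = algebraMap ℂ B (Qr n v : ℝ)) → ∃ h : A →ₐ[ℂ] B, ∀ v, h (f v) = g v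

theorem one_tmul_algebraMap (n : ℕ) (r : ℝ) :
    ((1 : ℂ) ⊗ₜ[ℝ] (algebraMap ℝ (Cl n) r) : CliffC n) = algebraMap ℂ _ (r : ℂ) := by
  rw [Algebra.algebraMap_eq_smul_one, TensorProduct.tmul_smul, Algebra.algebraMap_eq_smul_one,
    Algebra.TensorProduct.one_def, TensorProduct.smul_tmul', TensorProduct.smul_tmul']
  simp

noncomputable def iotaL (n : ℕ) : (Fin n → ℝ) →ₗ[ℝ] CliffC n where
  toFun := iotaC n
  map_add' x y := by simp [iotaC, TensorProduct.tmul_add]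
  map_smul' r x := by
    change iotaC n (r • x) = (r : ℂ) • iotaC n x
    simp only [iotaC, map_smul, TensorProduct.tmul_smul, TensorProduct.smul_tmul']
    simp

theorem gen_aux (n : ℕ) (y : Cl n) :
    ((1 : ℂ) ⊗ₜ[ℝ] y : CliffC n) ∈ Algebra.adjoin ℂ (Set.range (iotaL n)) := by
  induction y using CliffordAlgebra.induction with
  | algebraMap r => rw [one_tmul_algebraMap]; exact Subalgebra.algebraMap_mem _ _
  | ι v => exact Algebra.subset_adjoin ⟨v, rfl⟩
  | mul x y hx hy =>
    have : ((1 : ℂ) ⊗ₜ[ℝ] (x * y) : CliffC n) = ((1 : ℂ) ⊗ₜ[ℝ] x) * ((1 : ℂ) ⊗ₜ[ℝ] y) := by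
      simp
    rw [this]
    exact mul_mem hx hy
  | add x y hx hy =>
    rw [TensorProduct.tmul_add]
    exact add_mem hx hy

theorem isCliff (n : ℕ) : IsCliff n (CliffC n) (iotaL n) where
  sq v := by
    change iotaC n v * iotaC n v = _
    rw [iotaC, Algebra.TensorProduct.tmul_mul_tmul, CliffordAlgebra.ι_sq_scalar,
      one_mul, one_tmul_algebraMap]
  gen := by
    rw [eq_top_iff]
    intro x _
    induction x using TensorProduct.induction_on with
    | zero => exact zero_mem _
    | add x y hx hy => exact add_mem (hx trivial) (hy trivial)
    | tmul z y =>
      have e : z ⊗ₜ[ℝ] y = z • ((1 : ℂ) ⊗ₜ[ℝ] y : CliffC n) := by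
        rw [TensorProduct.smul_tmul']; simp
      rw [e]
      exact Subalgebra.smul_mem _ (gen_aux n y) z
  lift B _ _ g hg := by
    refine ⟨Algebra.TensorProduct.lift (Algebra.ofId ℂ B) (CliffordAlgebra.lift (Qr n) ⟨g, hg⟩)
      (fun x y => Algebra.commutes x _), fun v => ?_⟩
    refine (Algebra.TensorProduct.lift_tmul _ _ _ (1 : ℂ) (CliffordAlgebra.ι (Qr n) v)).trans ?_
    rw [map_one, one_mul, CliffordAlgebra.lift_ι_apply]

/-- drop the two first coordinates -/
def dropL (n : ℕ) : (Fin (n + 2) → ℝ) →ₗ[ℝ] (Fin n → ℝ) where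
  toFun v i := v i.succ.succ
  map_add' _ _ := rfl
  map_smul' _ _ := rfl

/-- insert two zero first coordinates -/
def embL (n : ℕ) : (Fin n → ℝ) →ₗ[ℝ] (Fin (n + 2) → ℝ) where
  toFun v := Matrix.vecCons 0 (Matrix.vecCons 0 v)
  map_add' _ _ := by simp
  map_smul' _ _ := by simp

def b0 (n : ℕ) : Fin (n + 2) → ℝ := Matrix.vecCons 1 (Matrix.vecCons 0 0)
def b1 (n : ℕ) : Fin (n + 2) → ℝ := Matrix.vecCons 0 (Matrix.vecCons 1 0)

theorem decomp (n : ℕ) (v : Fin (n + 2) → ℝ) :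
    v = v 0 • b0 n + v 1 • b1 n + embL n (dropL n v) := by
  ext i
  refine Fin.cases ?_ (fun i => Fin.cases ?_ (fun i => ?_) i) i <;> simp [b0, b1, embL, dropL]

theorem Qr_succ (n : ℕ) (v) : Qr (n + 2) v = -(v 0 * v 0) - v 1 * v 1 + Qr n (dropL n v) := by
  simp only [Qr_apply, Fin.sum_univ_succ, dropL]; simp; ring

theorem Qr_emb (n : ℕ) (v) : Qr (n + 2) (embL n v) = Qr n v := by
  rw [Qr_succ]; simp [embL, dropL]

theorem drop_b0 (n : ℕ) : dropL n (b0 n) = 0 := by ext; simp [dropL, b0]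
theorem drop_b1 (n : ℕ) : dropL n (b1 n) = 0 := by ext; simp [dropL, b1]
theorem drop_emb (n : ℕ) (v) : dropL n (embL n v) = v := by ext; simp [dropL, embL]

section Abstract

theorem IsCliff.anti {n : ℕ} {A : Type} [Ring A] [Algebra ℂ A] {f : (Fin n → ℝ) →ₗ[ℝ] A}
    (hA : IsCliff n A f) (v w) (h : ∑ i, v i * w i = 0) : f v * f w = -(f w * f v) := by
  have h1 := hA.sq (v + w)
  have h2 : Qr n (v + w) = Qr n v + Qr n w := by
    have : ∑ i, w i * v i = 0 := by rw [← h]; exact Finset.sum_congr rfl fun _ _ => mul_comm _ _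
    simp only [Qr_apply, Pi.add_apply, mul_add, add_mul, Finset.sum_add_distrib, h, this]; ring
  rw [h2, Complex.ofReal_add, map_add, map_add, ← hA.sq, ← hA.sq, mul_add, add_mul, add_mul] at h1
  rw [eq_neg_iff_add_eq_zero]
  have h3 := sub_eq_zero.mpr h1
  rw [← h3]; abel

theorem IsCliff.ext {n : ℕ} {A : Type} [Ring A] [Algebra ℂ A] {f : (Fin n → ℝ) →ₗ[ℝ] A}
    (hA : IsCliff n A f) {B : Type} [Semiring B] [Algebra ℂ B] {g h : A →ₐ[ℂ] B}
    (hh : ∀ v, g (f v) = h (f v)) : g = h := by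
  apply AlgHom.ext_of_adjoin_eq_top hA.gen
  rintro _ ⟨v, rfl⟩
  exact hh v

theorem IsCliff.comm {n : ℕ} {A : Type} [Ring A] [Algebra ℂ A] {f : (Fin n → ℝ) →ₗ[ℝ] A}
    (hA : IsCliff n A f) {B : Type} [Ring B] [Algebra ℂ B] (g : A →ₐ[ℂ] B) (b : B)
    (h : ∀ v, Commute (g (f v)) b) (x : A) : Commute (g x) b := by
  have hx : x ∈ Algebra.adjoin ℂ (Set.range f) := by rw [hA.gen]; trivial
  induction hx using Algebra.adjoin_induction with
  | mem x hx => obtain ⟨v, rfl⟩ := hx; exact h v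
  | algebraMap r => rw [AlgHom.commutes]; exact Algebra.commutes _ _
  | add x y _ _ hx hy => rw [map_add]; exact hx.add_left hy
  | mul x y _ _ hx hy => rw [map_mul]; exact hx.mul_left hy

variable {n : ℕ} {A C T : Type} [Ring A] [Algebra ℂ A] [Ring C] [Algebra ℂ C] [Ring T] [Algebra ℂ T]
  {f : (Fin n → ℝ) →ₗ[ℝ] A} {g : (Fin (n + 2) → ℝ) →ₗ[ℝ] C}

/-- Forward map. -/
theorem exists_fwd (hA : IsCliff n A f) (hC : IsCliff (n + 2) C g) (p : A →ₐ[ℂ] T)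
    (q : Matrix (Fin 2) (Fin 2) ℂ →ₐ[ℂ] T) (hpq : ∀ x y, Commute (p x) (q y)) :
    ∃ h : C →ₐ[ℂ] T, ∀ v, h (g v) = (v 0 : ℂ) • q M1 + (v 1 : ℂ) • q M2
      + p (f (dropL n v)) * q MK := by
  let F : (Fin (n + 2) → ℝ) →ₗ[ℝ] T :=
    { toFun := fun v => (v 0 : ℂ) • q M1 + (v 1 : ℂ) • q M2 + p (f (dropL n v)) * q MK
      map_add' := fun x y => by
        simp only [map_add, Pi.add_apply, add_mul, Complex.ofReal_add]; module
      map_smul' := fun c x => by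
        simp only [map_smul, Pi.smul_apply, smul_eq_mul, RingHom.id_apply, smul_add,
          Complex.ofReal_mul, mul_smul, Complex.coe_smul]
        rw [← Complex.coe_smul c (f _), map_smul, smul_mul_assoc, Complex.coe_smul] }
  apply hC.lift T F
  intro v
  change ((v 0 : ℂ) • q M1 + (v 1 : ℂ) • q M2 + p (f (dropL n v)) * q MK) *
    ((v 0 : ℂ) • q M1 + (v 1 : ℂ) • q M2 + p (f (dropL n v)) * q MK) = _
  have q11 : q M1 * q M1 = -1 := by rw [← map_mul, M11, map_neg, map_one]
  have q22 : q M2 * q M2 = -1 := by rw [← map_mul, M22, map_neg, map_one]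
  have qKK : q MK * q MK = 1 := by rw [← map_mul, MKK, map_one]
  have q21 : q M2 * q M1 = -(q M1 * q M2) := by rw [← map_mul, M21, map_neg, map_mul]
  have qK1 : q MK * q M1 = -(q M1 * q MK) := by rw [← map_mul, MK1, map_neg, map_mul]
  have qK2 : q MK * q M2 = -(q M2 * q MK) := by rw [← map_mul, MK2, map_neg, map_mul]
  have hp : p (f (dropL n v)) * p (f (dropL n v)) = ((Qr n (dropL n v) : ℝ) : ℂ) • (1 : T) := by
    rw [← map_mul, hA.sq, AlgHom.commutes, Algebra.algebraMap_eq_smul_one]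
  set P := p (f (dropL n v)) with hP
  have c1 : q M1 * (P * q MK) = P * (q M1 * q MK) := by
    rw [← mul_assoc, ← (hpq _ _).eq, mul_assoc]
  have c2 : q M2 * (P * q MK) = P * (q M2 * q MK) := by
    rw [← mul_assoc, ← (hpq _ _).eq, mul_assoc]
  have c3 : P * q MK * (P * q MK) = ((Qr n (dropL n v) : ℝ) : ℂ) • (1 : T) := by
    rw [(hpq _ MK).symm.mul_mul_mul_comm, hp, qKK, mul_one]
  have c4 : P * q MK * q M1 = -(P * (q M1 * q MK)) := by rw [mul_assoc, qK1, mul_neg]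
  have c5 : P * q MK * q M2 = -(P * (q M2 * q MK)) := by rw [mul_assoc, qK2, mul_neg]
  rw [Qr_succ, Algebra.algebraMap_eq_smul_one]
  simp only [add_mul, mul_add, smul_mul_assoc, mul_smul_comm, q11, q22, q21, c1, c2, c3, c4, c5]
  push_cast
  module

theorem exists_equiv (hA : IsCliff n A f) (hC : IsCliff (n + 2) C g) :
    Nonempty (C ≃ₐ[ℂ] (A ⊗[ℂ] Matrix (Fin 2) (Fin 2) ℂ)) := by
  obtain ⟨F, hF⟩ := exists_fwd hA hC
    (Algebra.TensorProduct.includeLeft : A →ₐ[ℂ] (A ⊗[ℂ] Matrix (Fin 2) (Fin 2) ℂ))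
    Algebra.TensorProduct.includeRight (fun x y => by simp [commute_iff_eq])
  simp only [Algebra.TensorProduct.includeLeft_apply, Algebra.TensorProduct.includeRight_apply,
    Algebra.TensorProduct.tmul_mul_tmul, mul_one, one_mul] at hF
  have b00 : g (b0 n) * g (b0 n) = -1 := by
    rw [hC.sq, Qr_succ, drop_b0]; simp [b0]
  have b11 : g (b1 n) * g (b1 n) = -1 := by
    rw [hC.sq, Qr_succ, drop_b1]; simp [b1]
  have b10 : g (b1 n) * g (b0 n) = -(g (b0 n) * g (b1 n)) := by
    apply hC.anti; simp [Fin.sum_univ_succ, b0, b1]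
  have be0 : ∀ v, g (embL n v) * g (b0 n) = -(g (b0 n) * g (embL n v)) := by
    intro v; apply hC.anti; simp [Fin.sum_univ_succ, b0, embL]
  have be1 : ∀ v, g (embL n v) * g (b1 n) = -(g (b1 n) * g (embL n v)) := by
    intro v; apply hC.anti; simp [Fin.sum_univ_succ, b1, embL]
  obtain ⟨K, hK⟩ : ∃ K, K = (-Complex.I) • (g (b0 n) * g (b1 n)) := ⟨_, rfl⟩
  have KK : K * K = 1 := by
    have h : g (b0 n) * g (b1 n) * (g (b0 n) * g (b1 n)) = -1 := by
      rw [mul_assoc, ← mul_assoc (g (b1 n)), b10, neg_mul, mul_assoc, b11, mul_neg_one, neg_neg,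
        b00]
    rw [hK, smul_mul_smul_comm, h]; simp
  have Ke : ∀ v, Commute (g (embL n v)) K := by
    intro v
    rw [hK]
    apply Commute.smul_right
    rw [commute_iff_eq, ← mul_assoc, be0, neg_mul, mul_assoc, be1, mul_neg, neg_neg, mul_assoc]
  have K0 : K * g (b0 n) = - (g (b0 n) * K) := by
    rw [hK, smul_mul_assoc, mul_smul_comm, mul_assoc, b10, mul_neg, smul_neg]
  have K1 : K * g (b1 n) = - (g (b1 n) * K) := by
    rw [hK, smul_mul_assoc, mul_smul_comm, ← mul_assoc (g (b1 n)), b10, neg_mul, smul_neg, neg_neg]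
  obtain ⟨G1, hG1⟩ := hA.lift C (LinearMap.mulRight ℝ K ∘ₗ g ∘ₗ embL n) (by
    intro v
    change g (embL n v) * K * (g (embL n v) * K) = _
    rw [(Ke v).symm.mul_mul_mul_comm, KK, hC.sq, mul_one, Qr_emb])
  replace hG1 : ∀ v, G1 (f v) = g (embL n v) * K := hG1
  obtain ⟨G2, hG2⟩ : ∃ G2 : Matrix (Fin 2) (Fin 2) ℂ →ₐ[ℂ] C,
      ∀ m, G2 m = matLin (g (b0 n)) (g (b1 n)) m :=
    ⟨matHom (g (b0 n)) (g (b1 n)) b00 b11 b10, fun m => rfl⟩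
  have hcomm : ∀ x y, Commute (G1 x) (G2 y) := by
    intro x y
    have h0 : Commute (G1 x) (g (b0 n)) := by
      apply hA.comm
      intro v
      rw [hG1, commute_iff_eq, mul_assoc, K0, mul_neg, ← mul_assoc, be0,
        neg_mul, neg_neg, mul_assoc]
    have h1 : Commute (G1 x) (g (b1 n)) := by
      apply hA.comm
      intro v
      rw [hG1, commute_iff_eq, mul_assoc, K1, mul_neg, ← mul_assoc, be1,
        neg_mul, neg_neg, mul_assoc]
    rw [hG2, matLin_apply]
    exact ((((Commute.one_right _).smul_right _).add_right (h0.smul_right _)).add_right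
      (h1.smul_right _)).add_right ((h0.mul_right h1).smul_right _)
  have G2_1 : G2 M1 = g (b0 n) := by
    have e : -(Complex.I * (Complex.I + Complex.I)) / 2 = 1 := by
      linear_combination -Complex.I_mul_I
    rw [hG2, matLin_apply]
    simp [M1, e]
  have G2_2 : G2 M2 = g (b1 n) := by
    rw [hG2, matLin_apply]
    simp [M2]
  have G2_K : G2 MK = K := by
    have e : -(Complex.I * (1 + 1)) / 2 = -Complex.I := by ring
    rw [hG2, matLin_apply, hK]
    simp [MK, e]
  obtain ⟨G, hG⟩ : ∃ G : (A ⊗[ℂ] Matrix (Fin 2) (Fin 2) ℂ) →ₐ[ℂ] C,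
      ∀ x y, G (x ⊗ₜ y) = G1 x * G2 y :=
    ⟨Algebra.TensorProduct.lift G1 G2 hcomm, fun x y => by simp⟩
  have F0 : F (g (b0 n)) = 1 ⊗ₜ M1 := by
    rw [hF, drop_b0]; simp [b0]
  have F1 : F (g (b1 n)) = 1 ⊗ₜ M2 := by
    rw [hF, drop_b1]; simp [b1]
  have Fe : ∀ v, F (g (embL n v)) = f v ⊗ₜ MK := by
    intro v; rw [hF, drop_emb]; simp [embL]
  have FG2 : ∀ m, F (G2 m) = 1 ⊗ₜ m := by
    intro m
    conv_rhs => rw [← matLin_M m]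
    rw [hG2, matLin_apply, matLin_apply]
    simp only [map_add, map_smul, map_mul, F0, F1, map_one, TensorProduct.tmul_add,
      TensorProduct.tmul_smul, Algebra.TensorProduct.tmul_mul_tmul, mul_one,
      Algebra.TensorProduct.one_def]
  refine ⟨AlgEquiv.ofAlgHom F G ?_ ?_⟩
  · apply Algebra.TensorProduct.ext
    · apply hA.ext
      intro v
      change F (G (f v ⊗ₜ 1)) = f v ⊗ₜ 1
      rw [hG, map_one, mul_one, hG1, map_mul, Fe, ← G2_K, FG2,
        Algebra.TensorProduct.tmul_mul_tmul, MKK, mul_one]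
    · apply AlgHom.ext
      intro m
      change F (G (1 ⊗ₜ m)) = 1 ⊗ₜ m
      rw [hG, map_one, one_mul, FG2]
  · apply hC.ext
    intro v
    rw [AlgHom.comp_apply, hF, map_add, map_add, map_smul, map_smul, hG, hG, hG, map_one, G2_1,
      G2_2, G2_K, hG1, mul_assoc, KK, one_mul, one_mul, mul_one, AlgHom.id_apply]
    conv_rhs => rw [decomp n v]
    simp only [map_add, map_smul, Complex.coe_smul]

end Abstract

/-- For every natural number `n`, there is a `ℂ`-algebra isomorphism
`ℂl_{n+2} ≅ ℂl_n ⊗_ℂ ℂ(2)`. -/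
theorem stmt2 (n : ℕ) :
    Nonempty (CliffC (n + 2) ≃ₐ[ℂ] (CliffC n ⊗[ℂ] Matrix (Fin 2) (Fin 2) ℂ)) := by
  exact exists_equiv (isCliff n) (isCliff (n + 2))
end

section
/- For every natural number n, there is an isomorphism of ℝ-algebras Cl_{n+8} ≅ Cl_n ⊗_ℝ ℝ(16), where ℝ(16) is the algebra of 16×16 real matrices. -/
open scoped TensorProduct

/-- Parity character on four-bit words. -/
def par16 : Fin 16 → ℤ := ![1, -1, -1, 1, -1, 1, 1, -1, -1, 1, 1, -1, 1, -1, -1, 1]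

/-- The sign pairing on four-bit words. -/
def sgn16 (s y : Fin 16) : ℤ := par16 (s &&& y)

theorem sgn16_xor_right : ∀ s y z : Fin 16, sgn16 s (y ^^^ z) = sgn16 s y * sgn16 s z := by
  decide +kernel

theorem sgn16_xor_left : ∀ s t y : Fin 16, sgn16 (s ^^^ t) y = sgn16 s y * sgn16 t y := by
  decide +kernel

theorem sgn16_sq : ∀ s y : Fin 16, sgn16 s y = 1 ∨ sgn16 s y = -1 := by
  decide +kernel

theorem sgn16_orth : ∀ y z : Fin 16, (∑ s, sgn16 s y * sgn16 s z) = if y = z then 16 else 0 := by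
  decide +kernel

theorem xor16_assoc : ∀ a b c : Fin 16, (a ^^^ b) ^^^ c = a ^^^ (b ^^^ c) := by
  decide +kernel

theorem xor16_cancel : ∀ a b : Fin 16, (a ^^^ b) ^^^ b = a := by
  decide +kernel

/-- Signed permutation (Pauli) matrices. -/
noncomputable def G (a s : Fin 16) : Matrix (Fin 16) (Fin 16) ℝ :=
  Matrix.of fun x y => if x = a ^^^ y then (sgn16 s y : ℝ) else 0

theorem G_mul (a s b t : Fin 16) :
    G a s * G b t = (sgn16 s b : ℝ) • G (a ^^^ b) (s ^^^ t) := by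
  ext x y
  simp only [G, Matrix.mul_apply, Matrix.of_apply, Matrix.smul_apply, mul_ite, mul_zero,
    Finset.sum_ite_eq', Finset.sum_ite_eq, Finset.mem_univ, if_true, smul_eq_mul]
  rw [xor16_assoc, sgn16_xor_right, sgn16_xor_left]
  split_ifs
  · push_cast; ring
  · simp

theorem G_one : G 0 0 = 1 := by
  ext x y
  have h : ∀ y : Fin 16, 0 ^^^ y = y := by decide +kernel
  have h2 : ∀ y : Fin 16, sgn16 0 y = 1 := by decide +kernel
  simp [G, Matrix.one_apply, h, h2]

/-- Permutation parts of the gamma matrices. -/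
def ga : Fin 8 → Fin 16 := ![1, 2, 3, 4, 5, 6, 7, 15]

/-- Sign parts of the gamma matrices. -/
def gs : Fin 8 → Fin 16 := ![1, 3, 6, 7, 4, 5, 10, 2]

/-- The gamma matrices. -/
noncomputable def gam (i : Fin 8) : Matrix (Fin 16) (Fin 16) ℝ := G (ga i) (gs i)

/-- The volume element. -/
noncomputable def om : Matrix (Fin 16) (Fin 16) ℝ := G 15 10

theorem xor16_comm : ∀ a b : Fin 16, a ^^^ b = b ^^^ a := by
  decide +kernel

theorem xor16_self : ∀ a : Fin 16, a ^^^ a = 0 := by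
  decide +kernel

theorem gam_anti (i j : Fin 8) :
    gam i * gam j + gam j * gam i = if i = j then (-2 : ℝ) • 1 else 0 := by
  have h : ∀ i j : Fin 8, sgn16 (gs i) (ga j) + sgn16 (gs j) (ga i) = if i = j then -2 else 0 := by
    decide +kernel
  have h' := congrArg (Int.cast : ℤ → ℝ) (h i j)
  unfold gam
  rw [G_mul, G_mul, xor16_comm (ga j), xor16_comm (gs j), ← add_smul]
  push_cast at h'
  rw [h']
  split_ifs with hij
  · subst hij
    rw [xor16_self, xor16_self, G_one]
  · simp

theorem om_sq : om * om = 1 := by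
  have h : sgn16 10 15 = 1 := by decide +kernel
  unfold om
  rw [G_mul, xor16_self, xor16_self, G_one, h]; simp

theorem gam_om (i : Fin 8) : gam i * om + om * gam i = 0 := by
  have h : ∀ i : Fin 8, sgn16 (gs i) 15 + sgn16 10 (ga i) = 0 := by
    decide +kernel
  have h' := congrArg (Int.cast : ℤ → ℝ) (h i)
  unfold gam om
  rw [G_mul, G_mul, xor16_comm 15, xor16_comm 10, ← add_smul]
  push_cast at h'
  rw [h']; simp

/-- Linear combination of gamma matrices. -/
noncomputable def gamL : (Fin 8 → ℝ) →ₗ[ℝ] Matrix (Fin 16) (Fin 16) ℝ :=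
  Fintype.linearCombination ℝ gam

theorem gamL_sq (w : Fin 8 → ℝ) : gamL w * gamL w = (-∑ i, w i * w i) • 1 := by
  have h1 : gamL w * gamL w = ∑ i, ∑ j, (w i * w j) • (gam i * gam j) := by
    simp only [gamL, Fintype.linearCombination_apply, Finset.sum_mul, Finset.mul_sum,
      smul_mul_assoc, mul_smul_comm, Finset.smul_sum, smul_smul]
    rw [Finset.sum_comm]
    refine Finset.sum_congr rfl fun i _ => Finset.sum_congr rfl fun j _ => ?_
    rw [mul_comm (w j)]
  have h2 : gamL w * gamL w = ∑ i, ∑ j, (w i * w j) • (gam j * gam i) := by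
    rw [h1, Finset.sum_comm]
    simp only [mul_comm]
  have h3 : (2 : ℝ) • (gamL w * gamL w) = (2 : ℝ) • ((-∑ i, w i * w i) • 1) := by
    rw [two_smul]
    nth_rewrite 1 [h1]
    rw [h2]
    simp only [← Finset.sum_add_distrib, ← smul_add, gam_anti, smul_ite, smul_zero,
      Finset.sum_ite_eq, Finset.mem_univ, if_true, smul_smul, ← Finset.sum_smul]
    congr 1
    rw [← Finset.sum_mul]; ring
  exact smul_right_injective _ (two_ne_zero' ℝ) h3

theorem gamL_om (w : Fin 8 → ℝ) : gamL w * om + om * gamL w = 0 := by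
  simp only [gamL, Fintype.linearCombination_apply, Finset.sum_mul, Finset.mul_sum,
      smul_mul_assoc, mul_smul_comm, ← Finset.sum_add_distrib, ← smul_add, gam_om, smul_zero,
      Finset.sum_const_zero]

theorem G_mem_mul (S : Subalgebra ℝ (Matrix (Fin 16) (Fin 16) ℝ)) {a s b t : Fin 16}
    (h : G a s ∈ S) (h' : G b t ∈ S) : G (a ^^^ b) (s ^^^ t) ∈ S := by
  have h1 := S.mul_mem h h'
  rw [G_mul] at h1
  rcases sgn16_sq s b with h2 | h2 <;> rw [h2] at h1
  · simpa using h1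
  · simpa using h1

theorem G_mem (S : Subalgebra ℝ (Matrix (Fin 16) (Fin 16) ℝ)) (hS : ∀ i, gam i ∈ S)
    (a s : Fin 16) : G a s ∈ S := by
  have sel : ∀ (b : Bool) (i : Fin 8),
      G (if b then ga i else 0) (if b then gs i else 0) ∈ S := by
    intro b i
    cases b
    · simpa [G_one] using S.one_mem
    · exact hS i
  have comb : ∀ c : Fin 8 → Bool, G
      ((List.finRange 8).foldr (fun i x => (if c i then ga i else 0) ^^^ x) 0)
      ((List.finRange 8).foldr (fun i x => (if c i then gs i else 0) ^^^ x) 0) ∈ S := by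
    intro c
    induction List.finRange 8 with
    | nil => simpa [G_one] using S.one_mem
    | cons i l ih => exact G_mem_mul S (sel (c i) i) ih
  have key : ∀ a s : Fin 16, ∃ c : Fin 8 → Bool,
      (List.finRange 8).foldr (fun i x => (if c i then ga i else 0) ^^^ x) 0 = a ∧
      (List.finRange 8).foldr (fun i x => (if c i then gs i else 0) ^^^ x) 0 = s := by
    intro a s
    let p : ℕ → Bool := fun k => a.val.testBit k
    let q : ℕ → Bool := fun k => s.val.testBit k
    refine ⟨![p 0 ^^ p 1 ^^ p 3 ^^ q 1 ^^ q 2 ^^ q 3, p 0 ^^ p 3 ^^ q 0 ^^ q 2 ^^ q 3,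
      p 2 ^^ p 3 ^^ q 2 ^^ q 3, p 0 ^^ p 2 ^^ p 3 ^^ q 0 ^^ q 1 ^^ q 3,
      p 1 ^^ p 2 ^^ p 3 ^^ q 1 ^^ q 3, p 0 ^^ p 1 ^^ p 2 ^^ p 3 ^^ q 0 ^^ q 3, q 3, p 3], ?_⟩
    revert a s
    decide +kernel
  obtain ⟨c, rfl, rfl⟩ := key a s
  exact comb c

theorem single_eq_G (x y : Fin 16) :
    Matrix.single x y (1 : ℝ) = (16 : ℝ)⁻¹ • ∑ s, (sgn16 s y : ℝ) • G (x ^^^ y) s := by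
  ext u v
  have h := congrArg (Int.cast : ℤ → ℝ) (sgn16_orth y v)
  push_cast at h
  have e : ∀ x y u : Fin 16, (u = (x ^^^ y) ^^^ y) ↔ x = u := by decide +kernel
  simp only [Matrix.single_apply, Matrix.smul_apply, Matrix.sum_apply, G, Matrix.of_apply,
    smul_eq_mul, mul_ite, mul_zero]
  by_cases hv : y = v
  · subst hv
    simp only [e, and_true]
    split_ifs with hu
    · rw [h]; simp
    · simp
  · simp only [hv, and_false, if_false] at h ⊢
    split_ifs
    · rw [h]; simp
    · simp

theorem gam_gen (S : Subalgebra ℝ (Matrix (Fin 16) (Fin 16) ℝ)) (hS : ∀ i, gam i ∈ S) :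
    S = ⊤ := by
  rw [eq_top_iff]
  intro M _
  rw [Matrix.matrix_eq_sum_single M]
  refine S.sum_mem fun i _ => S.sum_mem fun j _ => ?_
  have : Matrix.single i j (M i j) = (M i j) • Matrix.single i j (1 : ℝ) := by
    simp [Matrix.smul_single]
  rw [this, single_eq_G]
  exact S.smul_mem (S.smul_mem (S.sum_mem fun s _ => S.smul_mem (G_mem S hS _ _) _) _) _

/-- The generator map for the periodicity isomorphism. -/
noncomputable def phiL (n : ℕ) :
    (Fin (n + 8) → ℝ) →ₗ[ℝ] (Cl n ⊗[ℝ] Matrix (Fin 16) (Fin 16) ℝ) :=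
  (TensorProduct.mk ℝ (Cl n) (Matrix (Fin 16) (Fin 16) ℝ) 1) ∘ₗ gamL ∘ₗ
      LinearMap.funLeft ℝ ℝ (Fin.natAdd n) +
    ((TensorProduct.mk ℝ (Cl n) (Matrix (Fin 16) (Fin 16) ℝ)).flip om) ∘ₗ
      CliffordAlgebra.ι (Qr n) ∘ₗ LinearMap.funLeft ℝ ℝ (Fin.castAdd 8)

theorem phiL_apply (n : ℕ) (v : Fin (n + 8) → ℝ) :
    phiL n v = 1 ⊗ₜ gamL (fun i => v (Fin.natAdd n i)) +
      CliffordAlgebra.ι (Qr n) (fun i => v (Fin.castAdd 8 i)) ⊗ₜ om := rfl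

theorem phiL_sq (n : ℕ) (v : Fin (n + 8) → ℝ) :
    phiL n v * phiL n v = algebraMap ℝ _ (Qr (n + 8) v) := by
  have hQ : Qr (n + 8) v = (-∑ i : Fin 8, v (Fin.natAdd n i) * v (Fin.natAdd n i)) +
      Qr n (fun i => v (Fin.castAdd 8 i)) := by
    simp only [Qr, QuadraticMap.weightedSumSquares_apply, Fin.sum_univ_add, smul_eq_mul,
      neg_one_mul, Finset.sum_neg_distrib]
    ring
  rw [phiL_apply, hQ]
  generalize (fun i => v (Fin.castAdd 8 i)) = u
  have h := gamL_sq (fun i => v (Fin.natAdd n i))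
  have h' := gamL_om (fun i => v (Fin.natAdd n i))
  rw [add_mul, mul_add, mul_add]
  simp only [Algebra.TensorProduct.tmul_mul_tmul, one_mul, mul_one, h, om_sq,
    CliffordAlgebra.ι_sq_scalar]
  have h2 : CliffordAlgebra.ι (Qr n) u ⊗ₜ[ℝ] (gamL (fun i => v (Fin.natAdd n i)) * om) +
      CliffordAlgebra.ι (Qr n) u ⊗ₜ[ℝ] (om * gamL (fun i => v (Fin.natAdd n i))) = 0 := by
    rw [← TensorProduct.tmul_add, h', TensorProduct.tmul_zero]
  have h3 : ∀ r : ℝ, (1 : Cl n) ⊗ₜ[ℝ] (r • (1 : Matrix (Fin 16) (Fin 16) ℝ)) =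
      algebraMap ℝ _ r := by
    intro r
    rw [Algebra.algebraMap_eq_smul_one, Algebra.TensorProduct.one_def, TensorProduct.tmul_smul]
  have h4 : ∀ r : ℝ, (algebraMap ℝ (Cl n) r) ⊗ₜ[ℝ] (1 : Matrix (Fin 16) (Fin 16) ℝ) =
      algebraMap ℝ _ r := by
    intro r
    rw [Algebra.algebraMap_eq_smul_one, Algebra.algebraMap_eq_smul_one,
      Algebra.TensorProduct.one_def, TensorProduct.smul_tmul']
  rw [h3, h4, map_add, add_assoc, ← add_assoc (_ ⊗ₜ[ℝ] _) (_ ⊗ₜ[ℝ] _), h2, zero_add]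

/-- The periodicity homomorphism. -/
noncomputable def phi (n : ℕ) : Cl (n + 8) →ₐ[ℝ] (Cl n ⊗[ℝ] Matrix (Fin 16) (Fin 16) ℝ) :=
  CliffordAlgebra.lift (Qr (n + 8)) ⟨phiL n, phiL_sq n⟩

theorem phi_ι (n : ℕ) (v : Fin (n + 8) → ℝ) :
    phi n (CliffordAlgebra.ι _ v) = phiL n v := by
  unfold phi
  exact CliffordAlgebra.lift_ι_apply (phiL n) (phiL_sq n) v

theorem phi_surj (n : ℕ) : Function.Surjective (phi n) := by
  rw [← AlgHom.range_eq_top]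
  set R := (phi n).range with hR
  have hg : ∀ i, (1 : Cl n) ⊗ₜ[ℝ] gam i ∈ R := by
    intro i
    refine ⟨CliffordAlgebra.ι _ (Pi.single (Fin.natAdd n i) 1), ?_⟩
    change phi n _ = _
    rw [phi_ι, phiL_apply]
    have h1 : (fun j : Fin 8 => (Pi.single (Fin.natAdd n i) 1 : Fin (n + 8) → ℝ)
        (Fin.natAdd n j)) = Pi.single i 1 := by
      ext j; simp [Pi.single_apply]
    have h2 : (fun j : Fin n => (Pi.single (Fin.natAdd n i) 1 : Fin (n + 8) → ℝ)
        (Fin.castAdd 8 j)) = 0 := by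
      ext j
      simp only [Pi.single_apply, Pi.zero_apply, ite_eq_right_iff]
      intro h
      have := congrArg Fin.val h
      simp at this
      omega
    rw [h1, h2]
    simp [gamL, Fintype.linearCombination_apply_single]
  have hM : ∀ M, (1 : Cl n) ⊗ₜ[ℝ] M ∈ R := by
    have h := gam_gen (R.comap Algebra.TensorProduct.includeRight) hg
    intro M
    have : M ∈ R.comap (Algebra.TensorProduct.includeRight :
      Matrix (Fin 16) (Fin 16) ℝ →ₐ[ℝ] Cl n ⊗[ℝ] Matrix (Fin 16) (Fin 16) ℝ) := h ▸ trivial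
    exact this
  have hι : ∀ u, CliffordAlgebra.ι (Qr n) u ⊗ₜ[ℝ] (1 : Matrix (Fin 16) (Fin 16) ℝ) ∈ R := by
    intro u
    have h1 : phiL n (Fin.append u 0) ∈ R := ⟨CliffordAlgebra.ι _ (Fin.append u 0), phi_ι n _⟩
    rw [phiL_apply] at h1
    have h2 := R.mul_mem h1 (hM om)
    have h3 : (fun i : Fin 8 => Fin.append u (0 : Fin 8 → ℝ) (Fin.natAdd n i)) = 0 := by
      ext i; simp
    have h4 : (fun i : Fin n => Fin.append u (0 : Fin 8 → ℝ) (Fin.castAdd 8 i)) = u := by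
      ext i; simp
    rw [h3, h4] at h2
    simpa [om_sq] using h2
  have hA : ∀ a : Cl n, a ⊗ₜ[ℝ] (1 : Matrix (Fin 16) (Fin 16) ℝ) ∈ R := by
    intro a
    have h : Algebra.adjoin ℝ (Set.range (CliffordAlgebra.ι (Qr n))) ≤
        R.comap (Algebra.TensorProduct.includeLeft :
          Cl n →ₐ[ℝ] Cl n ⊗[ℝ] Matrix (Fin 16) (Fin 16) ℝ) := by
      rw [Algebra.adjoin_le_iff]
      rintro _ ⟨u, rfl⟩
      exact hι u
    rw [CliffordAlgebra.adjoin_range_ι] at h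
    exact h (Algebra.mem_top (x := a))
  rw [eq_top_iff]
  intro z _
  induction z using TensorProduct.induction_on with
  | zero => exact R.zero_mem
  | tmul a M => simpa using R.mul_mem (hA a) (hM M)
  | add x y hx hy => exact R.add_mem (hx trivial) (hy trivial)

/-- The monomial basis of the Clifford algebra. -/
noncomputable def clBasis (n : ℕ) : Module.Basis (Finset (Fin n)) ℝ (Cl n) :=
  (Pi.basisFun ℝ (Fin n)).ExteriorAlgebra.map (CliffordAlgebra.equivExterior (Qr n)).symm

theorem finrank_Cl (n : ℕ) : Module.finrank ℝ (Cl n) = 2 ^ n := by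
  rw [Module.finrank_eq_card_basis (clBasis n)]; simp

theorem finite_Cl (n : ℕ) : Module.Finite ℝ (Cl n) := Module.Finite.of_basis (clBasis n)

/-- For every natural number `n`, there is an `ℝ`-algebra isomorphism
`Cl_{n+8} ≅ Cl_n ⊗_ℝ ℝ(16)`. -/
theorem stmt3 (n : ℕ) :
    Nonempty (Cl (n + 8) ≃ₐ[ℝ] (Cl n ⊗[ℝ] Matrix (Fin 16) (Fin 16) ℝ)) := by
  have := finite_Cl n
  have := finite_Cl (n + 8)
  have hd : Module.finrank ℝ (Cl (n + 8)) =
      Module.finrank ℝ (Cl n ⊗[ℝ] Matrix (Fin 16) (Fin 16) ℝ) := by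
    rw [Module.finrank_tensorProduct, finrank_Cl, finrank_Cl, Module.finrank_matrix]
    simp [pow_add]
  have hinj : Function.Injective (phi n) :=
    (LinearMap.injective_iff_surjective_of_finrank_eq_finrank
      (f := (phi n).toLinearMap) hd).2 (phi_surj n)
  exact ⟨AlgEquiv.ofBijective (phi n) ⟨hinj, phi_surj n⟩⟩
end
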